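/- Let Λ be a nonempty finite set with N elements, Y a countable linearly ordered set, and for each λ ∈ Λ let M_λ and M'_λ be probability mass functions on Y. Let ε ≥ 0, θ ∈ (−1,∞), γ ∈ (0,1), and 0 < c ≤ C. Assume that for every λ ∈ Λ and every subset E ⊆ Y one has M_λ(E) ≤ e^ε·M'_λ(E) and M'_λ(E) ≤ e^ε·M_λ(E). Let (p_k)_{k≥1} be the probability mass function of NegBin(θ,γ), and let σ and σ' be any two adaptive strategies with density bounds (c,C). Then for every subset E ⊆ Y, A(p,σ,M)(E) ≤ exp( (2+θ)·(ε + log(C/c)) ) · A(p,σ',M')(E). -/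

import Mathlib

open scoped ENNReal BigOperators

/-- KL divergence (order-1 Rényi divergence) between two pmfs, valued in `EReal`. -/
noncomputable def klDiv' {Y : Type*} (p q : Y → ℝ≥0∞) : EReal :=
  open scoped Classical in
  if (∀ y, q y = 0 → p y = 0) ∧
      Summable (fun y => (p y).toReal * Real.log ((p y).toReal / (q y).toReal)) then
    ((∑' y, (p y).toReal * Real.log ((p y).toReal / (q y).toReal) : ℝ) : EReal)
  else ⊤

/-- Rényi divergence of order `α` between two pmfs on a countable set, valued in `EReal`. -/
noncomputable def renyiDiv {Y : Type*} (α : ℝ) (p q : Y → ℝ≥0∞) : EReal :=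
  open scoped Classical in
  if α = 1 then klDiv' p q
  else (((α - 1)⁻¹ : ℝ) : EReal) * ENNReal.log (∑' y, p y ^ α * q y ^ (1 - α))

/-- Probability of generating the sequence `ys` (given history `hist`) in the adaptive
process: at each step, sample `λ` from the strategy applied to the history so far,
then sample the next output from `M λ`. -/
noncomputable def seqProb {Λ Y : Type*} [Fintype Λ]
    (σ : List Y → Λ → ℝ≥0∞) (M : Λ → Y → ℝ≥0∞) : List Y → List Y → ℝ≥0∞
  | _, [] => 1
  | hist, y :: ys => (∑ l : Λ, σ hist l * M l y) * seqProb σ M (hist ++ [y]) ys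

/-- The DP-HyPO output distribution `A(p, σ, M)` : sample `T = k` with probability `p k`
(for `k ≥ 1`), run the adaptive process for `k` steps, and output the maximum. -/
noncomputable def hypoOut {Λ Y : Type*} [Fintype Λ] [LinearOrder Y]
    (p : ℕ → ℝ≥0∞) (σ : List Y → Λ → ℝ≥0∞) (M : Λ → Y → ℝ≥0∞) (y : Y) : ℝ≥0∞ :=
  ∑' k : ℕ, p (k + 1) *
    ∑' l : {l : List Y // l.length = k + 1 ∧ l.maximum = (y : WithBot Y)},
      seqProb σ M [] l.1

/-- `σ` is an adaptive strategy with density bounds `(c, C)`: to every history it assigns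
a probability vector on `Λ` whose entries lie in `[c/N, C/N]` where `N = card Λ`. -/
def IsStrategy {Λ Y : Type*} [Fintype Λ] (c C : ℝ) (σ : List Y → Λ → ℝ≥0∞) : Prop :=
  ∀ h : List Y, (∑ l : Λ, σ h l) = 1 ∧
    ∀ l : Λ, ENNReal.ofReal (c / Fintype.card Λ) ≤ σ h l ∧
      σ h l ≤ ENNReal.ofReal (C / Fintype.card Λ)

/-- The probability mass function of the truncated negative binomial distribution
`NegBin(θ, γ)` at `k`. -/
noncomputable def negBinPMF (θ γ : ℝ) (k : ℕ) : ℝ :=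
  open scoped Classical in
  if θ = 0 then (1 - γ) ^ k / (k * Real.log (1 / γ))
  else (1 - γ) ^ k / (γ ^ (-θ) - 1) * ∏ ℓ ∈ Finset.range k, ((ℓ : ℝ) + θ) / ((ℓ : ℝ) + 1)

/-- The mean of the truncated negative binomial distribution `NegBin(θ, γ)`. -/
noncomputable def negBinMean (θ γ : ℝ) : ℝ :=
  open scoped Classical in
  if θ = 0 then (1 / γ - 1) / Real.log (1 / γ)
  else θ * (1 - γ) / (γ * (1 - γ ^ θ))


/-- Rising factorial divided by factorial. -/
noncomputable def hypoRise (r : ℝ) (k : ℕ) : ℝ :=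
  ∏ ℓ ∈ Finset.range k, ((ℓ : ℝ) + r) / ((ℓ : ℝ) + 1)

lemma hypoRise_eq (r : ℝ) (k : ℕ) : Ring.choose (r + k - 1) k = hypoRise r k := by
  rw [← Ring.multichoose_eq]
  have h := Ring.factorial_nsmul_multichoose_eq_ascPochhammer r k
  have h2 : (ascPochhammer ℕ k).smeval r = k.factorial * hypoRise r k := by
    rw [Polynomial.ascPochhammer_smeval_eq_eval]
    clear h
    induction k with
    | zero => simp [hypoRise]
    | succ k ih =>
      rw [ascPochhammer_succ_eval, ih, hypoRise, hypoRise, Finset.prod_range_succ,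
        Nat.factorial_succ]
      push_cast
      have : (k : ℝ) + 1 ≠ 0 := by positivity
      field_simp
      ring
  rw [h2, nsmul_eq_mul] at h
  exact mul_left_cancel₀ (by positivity) h

lemma hypoRise_nonneg {r : ℝ} (hr : 0 < r) (k : ℕ) : 0 ≤ hypoRise r k :=
  Finset.prod_nonneg fun i _ => by positivity

lemma hypoRise_hasSum (r z : ℝ) (hz0 : 0 ≤ z) (hz1 : z < 1) :
    HasSum (fun k => hypoRise r k * z ^ k) ((1 - z) ^ (-r)) := by
  have h := (Real.one_div_one_sub_rpow_hasFPowerSeriesOnBall_zero r).hasSum (y := z)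
    (by simp [enorm_eq_nnnorm];
        rw [← NNReal.coe_lt_coe]; simpa [abs_of_nonneg hz0] using hz1)
  rw [Real.rpow_neg (by linarith), ← one_div]
  simpa [hypoRise_eq, mul_comm] using h

lemma negBin_succ {θ γ : ℝ} (hθ : -1 < θ) (hγ0 : 0 < γ) (hγ1 : γ < 1) :
    ∃ K : ℝ, 0 < K ∧ ∀ k : ℕ, negBinPMF θ γ (k + 1) =
      K * (hypoRise (θ + 1) k * (1 - γ) ^ k) / (k + 1) := by
  by_cases h : θ = 0
  · refine ⟨(1 - γ) / Real.log (1 / γ), ?_, ?_⟩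
    · have : 0 < Real.log (1 / γ) := Real.log_pos (by rw [lt_div_iff₀ hγ0]; linarith)
      have : 0 < 1 - γ := by linarith
      positivity
    · intro k
      have : hypoRise (θ + 1) k = 1 := by
        subst h
        refine Finset.prod_eq_one fun i _ => ?_
        rw [zero_add]; exact div_self (by positivity)
      rw [negBinPMF, if_pos h, this, pow_succ]
      push_cast
      rw [one_mul, mul_comm ((k : ℝ) + 1), ← div_div]
      ring
  · refine ⟨(1 - γ) * (θ / (γ ^ (-θ) - 1)), ?_, ?_⟩
    · have h1 : 0 < 1 - γ := by linarith
      refine mul_pos h1 ?_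
      rcases lt_or_gt_of_ne h with h | h
      · exact div_pos_of_neg_of_neg h (by
          have := Real.rpow_lt_one hγ0.le hγ1 (z := -θ) (by linarith)
          linarith)
      · exact div_pos h (by
          have := Real.one_lt_rpow_of_pos_of_lt_one_of_neg hγ0 hγ1 (z := -θ) (by linarith)
          linarith)
    · intro k
      have key : ∏ ℓ ∈ Finset.range (k + 1), ((ℓ : ℝ) + θ) / ((ℓ : ℝ) + 1)
          = θ * hypoRise (θ + 1) k / (k + 1) := by
        clear h
        induction k with
        | zero => simp [hypoRise]
        | succ k ih =>
          rw [Finset.prod_range_succ, ih, hypoRise, hypoRise, Finset.prod_range_succ]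
          have : (k : ℝ) + 1 ≠ 0 := by positivity
          have : (k : ℝ) + 1 + 1 ≠ 0 := by positivity
          push_cast
          field_simp
          ring
      rw [negBinPMF, if_neg h, key, pow_succ]
      ring

/-- Geometric two-variable sum. -/
def hypoGeom {R : Type*} [CommSemiring R] (a s : R) : ℕ → R
  | 0 => 0
  | k + 1 => a * hypoGeom a s k + s ^ k

lemma hypoGeom_mul (a s : ℝ) (k : ℕ) : (s - a) * hypoGeom a s k = s ^ k - a ^ k := by
  induction k with
  | zero => simp [hypoGeom]
  | succ k ih =>
    rw [hypoGeom, mul_add, mul_left_comm, ih]; ring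

lemma hypoGeom_self (a : ℝ) (k : ℕ) : hypoGeom a a (k + 1) = (k + 1) * a ^ k := by
  induction k with
  | zero => simp [hypoGeom]
  | succ k ih =>
    rw [hypoGeom, ih]; push_cast; ring

lemma hypoGeom_integral (a s : ℝ) (k : ℕ) :
    ∫ t in (0 : ℝ)..1, ((k : ℝ) + 1) * (a + t * (s - a)) ^ k = hypoGeom a s (k + 1) := by
  by_cases h : s = a
  · subst h; simp [hypoGeom_self]
  · have hne : s - a ≠ 0 := sub_ne_zero.2 h
    have hd : ∀ t ∈ Set.uIcc (0 : ℝ) 1,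
        HasDerivAt (fun t : ℝ => (a + t * (s - a)) ^ (k + 1) / (s - a))
          (((k : ℝ) + 1) * (a + t * (s - a)) ^ k) t := by
      intro t _
      have h1 : HasDerivAt (fun t : ℝ => a + t * (s - a)) (s - a) t := by
        simpa using ((hasDerivAt_id t).mul_const (s - a)).const_add a
      have h2 := (h1.pow (k + 1)).div_const (s - a)
      rw [mul_div_cancel_right₀ _ hne, Nat.add_sub_cancel] at h2
      push_cast at h2
      exact h2
    rw [intervalIntegral.integral_eq_sub_of_hasDerivAt hd
      ((by fun_prop : Continuous _).intervalIntegrable _ _)]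
    have := hypoGeom_mul a s (k + 1)
    field_simp
    rw [← mul_comm, this]
    ring

lemma hypoGeom_lintegral {a s : ℝ} (ha : 0 ≤ a) (hs : 0 ≤ s) (k : ℕ) :
    ∫⁻ t in Set.Ioc (0 : ℝ) 1, ENNReal.ofReal (((k : ℝ) + 1) * (a + t * (s - a)) ^ k)
      = ENNReal.ofReal (hypoGeom a s (k + 1)) := by
  rw [← hypoGeom_integral, intervalIntegral.integral_of_le zero_le_one,
    MeasureTheory.ofReal_integral_eq_lintegral_ofReal]
  · exact ((by fun_prop : Continuous fun t : ℝ => ((k : ℝ) + 1) * (a + t * (s - a)) ^ k).integrableOn_Icc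
      (a := 0) (b := 1)).mono_set Set.Ioc_subset_Icc_self
  · filter_upwards [MeasureTheory.ae_restrict_mem measurableSet_Ioc] with t ht
    have : 0 ≤ a + t * (s - a) := by nlinarith [ht.1, ht.2]
    simp only [Pi.zero_apply]
    positivity

/-- The divided difference of the generating function, as an integral. -/
lemma hypo_phi {θ γ : ℝ} (hθ : -1 < θ) (hγ0 : 0 < γ) (hγ1 : γ < 1) :
    ∃ K : ℝ, 0 < K ∧ ∀ a s : ℝ, 0 ≤ a → a ≤ 1 → 0 ≤ s → s ≤ 1 →
      ∑' k : ℕ, ENNReal.ofReal (negBinPMF θ γ (k + 1)) * ENNReal.ofReal (hypoGeom a s (k + 1))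
      = ∫⁻ t in Set.Ioc (0 : ℝ) 1,
          ENNReal.ofReal (K * (1 - (1 - γ) * (a + t * (s - a))) ^ (-(θ + 1))) := by
  obtain ⟨K, hK, hp⟩ := negBin_succ hθ hγ0 hγ1
  refine ⟨K, hK, fun a s ha0 ha1 hs0 hs1 => ?_⟩
  have hg : 0 ≤ 1 - γ := by linarith
  have hr : 0 < θ + 1 := by linarith
  simp_rw [← hypoGeom_lintegral ha0 hs0]
  have : ∀ k : ℕ, Measurable fun t : ℝ =>
      ENNReal.ofReal (((k : ℝ) + 1) * (a + t * (s - a)) ^ k) := fun k => by fun_prop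
  simp_rw [← MeasureTheory.lintegral_const_mul _ (this _)]
  rw [← MeasureTheory.lintegral_tsum (fun k => ((this k).const_mul _).aemeasurable)]
  refine MeasureTheory.setLIntegral_congr_fun measurableSet_Ioc fun t ht => ?_
  have hx0 : 0 ≤ a + t * (s - a) := by nlinarith [ht.1, ht.2]
  have hx1 : a + t * (s - a) ≤ 1 := by nlinarith [ht.1, ht.2]
  set x := a + t * (s - a) with hx
  have hS := (hypoRise_hasSum (θ + 1) ((1 - γ) * x) (by positivity) (by nlinarith)).mul_left K
  rw [← hS.tsum_eq, ENNReal.ofReal_tsum_of_nonneg _ hS.summable]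
  · refine tsum_congr fun k => ?_
    have h0 := hypoRise_nonneg hr k
    rw [← ENNReal.ofReal_mul (by rw [hp]; positivity), hp]
    congr 1
    have : (k : ℝ) + 1 ≠ 0 := by positivity
    rw [mul_pow]
    field_simp
  · intro k
    have h0 := hypoRise_nonneg hr k
    positivity

lemma hypo_phi_le {θ γ B a s a' s' : ℝ} (hθ : -1 < θ) (hγ0 : 0 < γ) (hγ1 : γ < 1)
    (hB : 1 ≤ B) (ha0 : 0 ≤ a) (ha1 : a ≤ 1) (hs0 : 0 ≤ s) (hs1 : s ≤ 1)
    (ha0' : 0 ≤ a') (ha1' : a' ≤ 1) (hs0' : 0 ≤ s') (hs1' : s' ≤ 1)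
    (hA : 1 + B * a ≤ a' + B) (hS : 1 + B * s ≤ s' + B) :
    ∑' k : ℕ, ENNReal.ofReal (negBinPMF θ γ (k + 1)) * ENNReal.ofReal (hypoGeom a s (k + 1))
    ≤ ENNReal.ofReal (B ^ (θ + 1)) * ∑' k : ℕ, ENNReal.ofReal (negBinPMF θ γ (k + 1)) *
        ENNReal.ofReal (hypoGeom a' s' (k + 1)) := by
  obtain ⟨K, hK, h⟩ := hypo_phi hθ hγ0 hγ1
  rw [h a s ha0 ha1 hs0 hs1, h a' s' ha0' ha1' hs0' hs1',
    ← MeasureTheory.lintegral_const_mul' _ _ ENNReal.ofReal_ne_top]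
  refine MeasureTheory.setLIntegral_mono' measurableSet_Ioc fun t ht => ?_
  rw [← ENNReal.ofReal_mul (by positivity)]
  refine ENNReal.ofReal_le_ofReal ?_
  have hx1 : a + t * (s - a) ≤ 1 := by nlinarith [ht.1, ht.2]
  have hx1' : a' + t * (s' - a') ≤ 1 := by nlinarith [ht.1, ht.2]
  have hxx : 1 + B * (a + t * (s - a)) ≤ a' + t * (s' - a') + B := by
    nlinarith [mul_le_mul_of_nonneg_left hA (sub_nonneg.2 ht.2),
      mul_le_mul_of_nonneg_left hS ht.1.le]
  set x := a + t * (s - a)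
  set x' := a' + t * (s' - a')
  have hu : 0 < 1 - (1 - γ) * x := by nlinarith
  have hu' : 0 < 1 - (1 - γ) * x' := by nlinarith
  have huu : 1 - (1 - γ) * x' ≤ B * (1 - (1 - γ) * x) := by
    nlinarith [mul_le_mul_of_nonneg_left hxx (by linarith : (0:ℝ) ≤ 1 - γ)]
  set u := 1 - (1 - γ) * x
  set u' := 1 - (1 - γ) * x'
  have : (B * u) ^ (-(θ + 1)) ≤ u' ^ (-(θ + 1)) :=
    Real.rpow_le_rpow_of_nonpos hu' huu (by linarith)
  rw [Real.mul_rpow (by linarith) hu.le, Real.rpow_neg (by linarith)] at this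
  have hBp : 0 < B ^ (θ + 1) := Real.rpow_pos_of_pos (by linarith) _
  calc K * u ^ (-(θ + 1)) = B ^ (θ + 1) * (K * ((B ^ (θ + 1))⁻¹ * u ^ (-(θ + 1)))) := by
        field_simp
    _ ≤ _ := by gcongr

/-- Sum of sequence probabilities over lists of length `n` satisfying `P`. -/
noncomputable def hypoS {Λ Y : Type*} [Fintype Λ]
    (σ : List Y → Λ → ℝ≥0∞) (M : Λ → Y → ℝ≥0∞) (n : ℕ) (h : List Y) (P : List Y → Prop) : ℝ≥0∞ :=
  open scoped Classical in
  ∑' l : List Y, if l.length = n ∧ P l then seqProb σ M h l else 0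

/-- One-step distribution. -/
noncomputable def hypoQ {Λ Y : Type*} [Fintype Λ]
    (σ : List Y → Λ → ℝ≥0∞) (M : Λ → Y → ℝ≥0∞) (h : List Y) (z : Y) : ℝ≥0∞ :=
  ∑ l : Λ, σ h l * M l z

section
variable {Λ Y : Type*} [Fintype Λ] (σ : List Y → Λ → ℝ≥0∞) (M : Λ → Y → ℝ≥0∞)

lemma hypoS_zero (h : List Y) (P : List Y → Prop) [Decidable (P [])] :
    hypoS σ M 0 h P = if P [] then 1 else 0 := by
  classical
  rw [hypoS, tsum_eq_single []]
  · simp [seqProb]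
  · intro l hl
    simp [hl]

lemma hypoS_succ (n : ℕ) (h : List Y) (P : List Y → Prop) :
    hypoS σ M (n + 1) h P
      = ∑' z, hypoQ σ M h z * hypoS σ M n (h ++ [z]) (fun l => P (z :: l)) := by
  classical
  have hinj : Function.Injective (fun x : Y × List Y => x.1 :: x.2) := by
    rintro ⟨a, b⟩ ⟨c, d⟩ h; simpa using h
  rw [hypoS, ← hinj.tsum_eq, ENNReal.tsum_prod']
  · refine tsum_congr fun z => ?_
    rw [hypoS, ← ENNReal.tsum_mul_left]
    refine tsum_congr fun l => ?_
    simp [seqProb, hypoQ]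
  · intro l hl
    cases l with
    | nil => simp at hl
    | cons z l => exact ⟨(z, l), rfl⟩

lemma hypoS_congr (n : ℕ) (h : List Y) {P Q : List Y → Prop} (hPQ : ∀ l, P l ↔ Q l) :
    hypoS σ M n h P = hypoS σ M n h Q := by
  congr 1; ext l; exact hPQ l

lemma hypoS_false (n : ℕ) (h : List Y) {P : List Y → Prop} (hP : ∀ l, ¬ P l) :
    hypoS σ M n h P = 0 := by
  simp [hypoS, hP]

variable [LinearOrder Y]

lemma hypoS_le_succ (y : Y) (n : ℕ) (h : List Y) :
    hypoS σ M (n + 1) h (fun l => l.maximum ≤ (y : WithBot Y))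
      = ∑' z, (if z ≤ y then hypoQ σ M h z else 0) *
          hypoS σ M n (h ++ [z]) (fun l => l.maximum ≤ (y : WithBot Y)) := by
  rw [hypoS_succ]
  refine tsum_congr fun z => ?_
  split_ifs with hz
  · congr 1
    apply hypoS_congr
    intro l
    simp [List.maximum_cons, hz]
  · rw [hypoS_false]
    · simp
    · intro l
      simp [List.maximum_cons, hz]

lemma hypoS_eq_succ (y : Y) (n : ℕ) (h : List Y) :
    hypoS σ M (n + 1) h (fun l => l.maximum = (y : WithBot Y))
      = (∑' z, (if z < y then hypoQ σ M h z else 0) *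
          hypoS σ M n (h ++ [z]) (fun l => l.maximum = (y : WithBot Y))) +
        hypoQ σ M h y * hypoS σ M n (h ++ [y]) (fun l => l.maximum ≤ (y : WithBot Y)) := by
  rw [hypoS_succ]
  rw [← tsum_ite_eq y (fun z => hypoQ σ M h z * 
    hypoS σ M n (h ++ [z]) (fun l => l.maximum ≤ (y : WithBot Y))), ← ENNReal.tsum_add]
  refine tsum_congr fun z => ?_
  rcases lt_trichotomy z y with hz | hz | hz
  · simp only [hz, hz.ne, if_true, if_false, add_zero]
    congr 1
    apply hypoS_congr
    intro l
    have : (z : WithBot Y) < y := by exact_mod_cast hz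
    rw [List.maximum_cons]
    constructor
    · intro e
      rcases max_choice (z : WithBot Y) l.maximum with e' | e'
      · rw [e'] at e; exact absurd e this.ne
      · rw [← e', e]
    · intro e
      rw [e, max_eq_right this.le]
  · subst hz
    simp only [lt_irrefl, if_true, if_false, zero_mul, zero_add]
    congr 1
    apply hypoS_congr
    intro l
    simp [List.maximum_cons]
  · simp only [hz.not_gt, hz.ne', if_false, zero_mul, add_zero]
    rw [hypoS_false, mul_zero]
    intro l e
    have : (y : WithBot Y) < z := by exact_mod_cast hz
    rw [List.maximum_cons] at e
    exact absurd (le_max_left (z : WithBot Y) l.maximum) (by rw [e]; exact not_le.2 this)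

lemma hypo_upper {y : Y} {a b s : ℝ≥0∞}
    (ha : ∀ h, (∑' z, if z < y then hypoQ σ M h z else 0) ≤ a)
    (hs : ∀ h, (∑' z, if z ≤ y then hypoQ σ M h z else 0) ≤ s)
    (hb : ∀ h, hypoQ σ M h y ≤ b) (n : ℕ) :
    ∀ h, hypoS σ M n h (fun l => l.maximum = (y : WithBot Y)) ≤ b * hypoGeom a s n := by
  have hL : ∀ n h, hypoS σ M n h (fun l => l.maximum ≤ (y : WithBot Y)) ≤ s ^ n := by
    intro n
    induction n with
    | zero => intro h; simp [hypoS_zero]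
    | succ n ih =>
      intro h
      rw [hypoS_le_succ, pow_succ']
      refine (ENNReal.tsum_le_tsum fun z => mul_le_mul_right (ih _) _).trans ?_
      rw [ENNReal.tsum_mul_right]
      exact mul_le_mul_left (hs h) _
  induction n with
  | zero => intro h; simp [hypoS_zero, hypoGeom]
  | succ n ih =>
    intro h
    rw [hypoS_eq_succ, hypoGeom, mul_add, mul_left_comm]
    refine add_le_add ?_ (mul_le_mul' (hb h) (hL n _))
    refine (ENNReal.tsum_le_tsum fun z => mul_le_mul_right (ih _) _).trans ?_
    rw [ENNReal.tsum_mul_right]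
    exact mul_le_mul_left (ha h) _

lemma hypo_lower {y : Y} {a b s : ℝ≥0∞}
    (ha : ∀ h, a ≤ (∑' z, if z < y then hypoQ σ M h z else 0))
    (hs : ∀ h, s ≤ (∑' z, if z ≤ y then hypoQ σ M h z else 0))
    (hb : ∀ h, b ≤ hypoQ σ M h y) (n : ℕ) :
    ∀ h, b * hypoGeom a s n ≤ hypoS σ M n h (fun l => l.maximum = (y : WithBot Y)) := by
  have hL : ∀ n h, s ^ n ≤ hypoS σ M n h (fun l => l.maximum ≤ (y : WithBot Y)) := by
    intro n
    induction n with
    | zero => intro h; simp [hypoS_zero]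
    | succ n ih =>
      intro h
      rw [hypoS_le_succ, pow_succ']
      refine le_trans ?_ (ENNReal.tsum_le_tsum fun z => mul_le_mul_right (ih _) _)
      rw [ENNReal.tsum_mul_right]
      exact mul_le_mul_left (hs h) _
  induction n with
  | zero => intro h; simp [hypoS_zero, hypoGeom]
  | succ n ih =>
    intro h
    rw [hypoS_eq_succ, hypoGeom, mul_add, mul_left_comm]
    refine add_le_add ?_ (mul_le_mul' (hb h) (hL n _))
    refine le_trans ?_ (ENNReal.tsum_le_tsum fun z => mul_le_mul_right (ih _) _)
    rw [ENNReal.tsum_mul_right]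
    exact mul_le_mul_left (ha h) _

lemma hypoOut_eq (p : ℕ → ℝ≥0∞) (y : Y) :
    hypoOut p σ M y
      = ∑' k : ℕ, p (k + 1) * hypoS σ M (k + 1) [] (fun l => l.maximum = (y : WithBot Y)) := by
  classical
  refine tsum_congr fun k => ?_
  congr 1
  rw [hypoS]
  refine (tsum_subtype {l : List Y | l.length = k + 1 ∧ l.maximum = (y : WithBot Y)}
    (fun l => seqProb σ M [] l)).trans ?_
  refine tsum_congr fun l => ?_
  simp only [Set.indicator, Set.mem_ofPred_eq]
  congr

end

lemma hypoGeom_ofReal {a s : ℝ} (ha : 0 ≤ a) (hs : 0 ≤ s) (n : ℕ) :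
    hypoGeom (ENNReal.ofReal a) (ENNReal.ofReal s) n = ENNReal.ofReal (hypoGeom a s n) ∧
      0 ≤ hypoGeom a s n := by
  induction n with
  | zero => simp [hypoGeom]
  | succ n ih =>
    obtain ⟨h1, h2⟩ := ih
    refine ⟨?_, by rw [hypoGeom]; positivity⟩
    rw [hypoGeom, hypoGeom, h1, ENNReal.ofReal_add (by positivity) (by positivity),
      ENNReal.ofReal_mul ha, ENNReal.ofReal_pow hs]

lemma hypoQ_le {Λ Y : Type*} [Fintype Λ] [Nonempty Λ] {ε c C : ℝ}
    (hc : 0 < c) (hcC : c ≤ C) {M M' : Λ → Y → ℝ≥0∞}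
    (hDP : ∀ l z, M l z ≤ ENNReal.ofReal (Real.exp ε) * M' l z)
    {σ σ' : List Y → Λ → ℝ≥0∞} (hσ : IsStrategy c C σ) (hσ' : IsStrategy c C σ')
    (h h' : List Y) (z : Y) :
    hypoQ σ M h z ≤ ENNReal.ofReal (Real.exp ε * (C / c)) * hypoQ σ' M' h' z := by
  rw [hypoQ, hypoQ, Finset.mul_sum]
  refine Finset.sum_le_sum fun l _ => ?_
  have hN : (0 : ℝ) < Fintype.card Λ := by exact_mod_cast Fintype.card_pos
  have hC : 0 < C := by linarith
  calc σ h l * M l z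
      ≤ ENNReal.ofReal (C / Fintype.card Λ) * (ENNReal.ofReal (Real.exp ε) * M' l z) :=
        mul_le_mul' ((hσ h).2 l).2 (hDP l z)
    _ = ENNReal.ofReal (Real.exp ε * (C / c)) *
          (ENNReal.ofReal (c / Fintype.card Λ) * M' l z) := by
        rw [← mul_assoc, ← mul_assoc, ← ENNReal.ofReal_mul (by positivity),
          ← ENNReal.ofReal_mul (by positivity)]
        congr 2
        field_simp
    _ ≤ _ := by
        gcongr
        exact ((hσ' h').2 l).1

lemma hypoQ_sum {Λ Y : Type*} [Fintype Λ] {c C : ℝ} {M : Λ → Y → ℝ≥0∞}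
    (hM : ∀ l, ∑' y, M l y = 1) {σ : List Y → Λ → ℝ≥0∞} (hσ : IsStrategy c C σ) (h : List Y) :
    ∑' z, hypoQ σ M h z = 1 := by
  simp only [hypoQ]
  rw [Summable.tsum_finsetSum fun _ _ => ENNReal.summable]
  simp_rw [ENNReal.tsum_mul_left, hM, mul_one]
  exact (hσ h).1

lemma hypo_compl {Y : Type*} {q q' : Y → ℝ≥0∞} {B : ℝ≥0∞} (hq : ∑' z, q z = 1)
    (hq' : ∑' z, q' z = 1) (hB : ∀ z, q' z ≤ B * q z) (P : Y → Prop) [DecidablePred P] :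
    1 + B * (∑' z, if P z then q z else 0) ≤ (∑' z, if P z then q' z else 0) + B := by
  have split : ∀ f : Y → ℝ≥0∞, ∑' z, f z
      = (∑' z, if P z then f z else 0) + ∑' z, if P z then 0 else f z := by
    intro f
    rw [← ENNReal.tsum_add]
    refine tsum_congr fun z => ?_
    split_ifs <;> simp
  have hle : (∑' z, if P z then 0 else q' z) ≤ B * ∑' z, if P z then 0 else q z := by
    rw [← ENNReal.tsum_mul_left]
    refine ENNReal.tsum_le_tsum fun z => ?_
    split_ifs
    · simp
    · exact hB z
  calc 1 + B * (∑' z, if P z then q z else 0)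
      = (∑' z, if P z then q' z else 0) + (∑' z, if P z then 0 else q' z)
          + B * (∑' z, if P z then q z else 0) := by rw [← split, hq']
    _ ≤ (∑' z, if P z then q' z else 0) + (B * ∑' z, if P z then 0 else q z)
          + B * (∑' z, if P z then q z else 0) := by gcongr
    _ = (∑' z, if P z then q' z else 0) + B * ∑' z, q z := by rw [split q]; ring
    _ = _ := by rw [hq, mul_one]

lemma hypo_supinf {ι : Type*} [Nonempty ι] {B : ℝ} (hB : 0 ≤ B) {f g : ι → ℝ≥0∞}
    (hf : ∀ i, f i ≤ 1) (hg : ∀ i, g i ≤ 1)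
    (h : ∀ i j, 1 + ENNReal.ofReal B * f i ≤ g j + ENNReal.ofReal B) :
    ∃ a a' : ℝ, 0 ≤ a ∧ a ≤ 1 ∧ 0 ≤ a' ∧ a' ≤ 1 ∧ 1 + B * a ≤ a' + B ∧
      (∀ i, f i ≤ ENNReal.ofReal a) ∧ (∀ i, ENNReal.ofReal a' ≤ g i) := by
  have hF : ⨆ i, f i ≤ 1 := iSup_le hf
  have hG : ⨅ i, g i ≤ 1 := (iInf_le _ (Classical.arbitrary ι)).trans (hg _)
  have hF' : ⨆ i, f i ≠ ⊤ := ne_top_of_le_ne_top ENNReal.one_ne_top hF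
  have hG' : ⨅ i, g i ≠ ⊤ := ne_top_of_le_ne_top ENNReal.one_ne_top hG
  refine ⟨(⨆ i, f i).toReal, (⨅ i, g i).toReal, ENNReal.toReal_nonneg, ?_,
    ENNReal.toReal_nonneg, ?_, ?_, ?_, ?_⟩
  · exact ENNReal.toReal_le_of_le_ofReal zero_le_one (by simpa using hF)
  · exact ENNReal.toReal_le_of_le_ofReal zero_le_one (by simpa using hG)
  · have key : 1 + ENNReal.ofReal B * (⨆ i, f i) ≤ (⨅ i, g i) + ENNReal.ofReal B := by
      rw [ENNReal.mul_iSup, ENNReal.add_iSup, ENNReal.iInf_add]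
      exact iSup_le fun i => le_iInf fun j => h i j
    have := ENNReal.toReal_mono (by finiteness) key
    rwa [ENNReal.toReal_add (by finiteness) (by finiteness),
      ENNReal.toReal_add (by finiteness) (by finiteness), ENNReal.toReal_mul,
      ENNReal.toReal_ofReal hB, ENNReal.toReal_one] at this
  · intro i; rw [ENNReal.ofReal_toReal hF']; exact le_iSup f i
  · intro i; rw [ENNReal.ofReal_toReal hG']; exact iInf_le g i

/-- **DP-HyPO privacy guarantee (pure DP, truncated negative binomial stopping).**
If every base algorithm is `(ε, 0)`-DP (i.e. `M λ (E) ≤ e^ε M' λ (E)` and conversely for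
every event `E`), the number of runs follows `NegBin(θ, γ)`, and `σ, σ'` are adaptive
strategies with density bounds `(c, C)`, then for every event `E` the DP-HyPO output
distributions satisfy `A(p,σ,M)(E) ≤ exp((2+θ)(ε + log(C/c))) · A(p,σ',M')(E)`. -/
theorem dp_hypo_pure_negBin {Λ Y : Type*} [Fintype Λ] [Nonempty Λ]
    [Countable Y] [LinearOrder Y]
    (ε θ γ c C : ℝ)
    (hε : 0 ≤ ε) (hθ : -1 < θ) (hγ0 : 0 < γ) (hγ1 : γ < 1) (hc : 0 < c) (hcC : c ≤ C)
    (M M' : Λ → Y → ℝ≥0∞)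
    (hM : ∀ l : Λ, ∑' y : Y, M l y = 1) (hM' : ∀ l : Λ, ∑' y : Y, M' l y = 1)
    (hDP : ∀ (l : Λ) (E : Set Y),
      (∑' y : E, M l y) ≤ ENNReal.ofReal (Real.exp ε) * ∑' y : E, M' l y ∧
      (∑' y : E, M' l y) ≤ ENNReal.ofReal (Real.exp ε) * ∑' y : E, M l y)
    (p : ℕ → ℝ≥0∞) (hp : ∀ k : ℕ, p (k + 1) = ENNReal.ofReal (negBinPMF θ γ (k + 1)))
    (σ σ' : List Y → Λ → ℝ≥0∞)
    (hσ : IsStrategy c C σ) (hσ' : IsStrategy c C σ') :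
    ∀ E : Set Y,
      (∑' y : E, hypoOut p σ M y) ≤
        ENNReal.ofReal (Real.exp ((2 + θ) * (ε + Real.log (C / c)))) *
          ∑' y : E, hypoOut p σ' M' y := by
  intro E
  have hC : 0 < C := by linarith
  have hCc : 1 ≤ C / c := by rw [le_div_iff₀ hc]; linarith
  have hB : 1 ≤ Real.exp ε * (C / c) := by
    have := Real.one_le_exp hε
    nlinarith
  have hexp : Real.exp ((2 + θ) * (ε + Real.log (C / c)))
      = (Real.exp ε * (C / c)) ^ (θ + 1) * (Real.exp ε * (C / c)) := by
    have hBp : 0 < Real.exp ε * (C / c) := by linarith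
    rw [← Real.rpow_add_one hBp.ne', Real.rpow_def_of_pos hBp,
      Real.log_mul (Real.exp_pos _).ne' (by positivity), Real.log_exp]
    congr 1
    ring
  have hD1 : ∀ l z, M l z ≤ ENNReal.ofReal (Real.exp ε) * M' l z := by
    intro l z
    simpa using (hDP l {z}).1
  have hD2 : ∀ l z, M' l z ≤ ENNReal.ofReal (Real.exp ε) * M l z := by
    intro l z
    simpa using (hDP l {z}).2
  have hQ1 := hypoQ_le hc hcC hD1 hσ hσ'
  have hQ2 := hypoQ_le hc hcC hD2 hσ' hσ
  set B := Real.exp ε * (C / c) with hBdef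
  rw [← ENNReal.tsum_mul_left]
  refine ENNReal.tsum_le_tsum fun y => ?_
  obtain ⟨y, hy⟩ := y
  simp only
  have hle : ∀ (q : Y → ℝ≥0∞), ∑' z, q z = 1 → ∀ (P : Y → Prop) [DecidablePred P],
      (∑' z, if P z then q z else 0) ≤ 1 := by
    intro q hq P _
    rw [← hq]
    refine ENNReal.tsum_le_tsum fun z => ?_
    split_ifs <;> simp
  have hs := hypoQ_sum hM hσ
  have hs' := hypoQ_sum hM' hσ'
  obtain ⟨a, a', ha0, ha1, ha0', ha1', haa, hfa, hga⟩ := hypo_supinf (B := B) (by linarith)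
    (f := fun h => ∑' z, if z < y then hypoQ σ M h z else 0)
    (g := fun h => ∑' z, if z < y then hypoQ σ' M' h z else 0)
    (fun h => hle _ (hs h) _) (fun h => hle _ (hs' h) _)
    (fun h h' => hypo_compl (hs h) (hs' h') (hQ2 h' h) _)
  obtain ⟨s, s', hs0, hs1, hs0', hs1', hss, hfs, hgs⟩ := hypo_supinf (B := B) (by linarith)
    (f := fun h => ∑' z, if z ≤ y then hypoQ σ M h z else 0)
    (g := fun h => ∑' z, if z ≤ y then hypoQ σ' M' h z else 0)
    (fun h => hle _ (hs h) _) (fun h => hle _ (hs' h) _)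
    (fun h h' => hypo_compl (hs h) (hs' h') (hQ2 h' h) _)
  set b := ⨆ h, hypoQ σ M h y with hb
  set b' := ⨅ h, hypoQ σ' M' h y with hb'
  have hbb : b ≤ ENNReal.ofReal B * b' := by
    rw [hb, hb', ENNReal.mul_iInf_of_ne (by simp; linarith) ENNReal.ofReal_ne_top]
    exact iSup_le fun h => le_iInf fun h' => hQ1 h h' y
  have hU := hypo_upper σ M hfa hfs (fun h => le_iSup (fun h => hypoQ σ M h y) h)
  have hL := hypo_lower σ' M' hga hgs (fun h => iInf_le (fun h => hypoQ σ' M' h y) h)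
  have hphi := hypo_phi_le hθ hγ0 hγ1 hB ha0 ha1 hs0 hs1 ha0' ha1' hs0' hs1' haa hss
  rw [hypoOut_eq, hypoOut_eq]
  calc ∑' k : ℕ, p (k + 1) * hypoS σ M (k + 1) [] (fun l => l.maximum = (y : WithBot Y))
      ≤ ∑' k : ℕ, b * (ENNReal.ofReal (negBinPMF θ γ (k + 1)) *
          ENNReal.ofReal (hypoGeom a s (k + 1))) := by
        refine ENNReal.tsum_le_tsum fun k => ?_
        rw [hp, ← (hypoGeom_ofReal ha0 hs0 _).1, mul_left_comm]
        exact mul_le_mul_right (hU _ _) _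
    _ ≤ (ENNReal.ofReal B * b') * (ENNReal.ofReal (B ^ (θ + 1)) *
          ∑' k : ℕ, ENNReal.ofReal (negBinPMF θ γ (k + 1)) *
            ENNReal.ofReal (hypoGeom a' s' (k + 1))) := by
        rw [ENNReal.tsum_mul_left]
        exact mul_le_mul' hbb hphi
    _ = ENNReal.ofReal (B ^ (θ + 1) * B) * ∑' k : ℕ, b' *
          (ENNReal.ofReal (negBinPMF θ γ (k + 1)) *
            ENNReal.ofReal (hypoGeom a' s' (k + 1))) := by
        rw [ENNReal.tsum_mul_left, ENNReal.ofReal_mul (p := B ^ (θ + 1)) (q := B) (by positivity)]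
        ring
    _ ≤ _ := by
        rw [hexp]
        refine mul_le_mul_right (ENNReal.tsum_le_tsum fun k => ?_) _
        rw [hp, ← (hypoGeom_ofReal ha0' hs0' _).1, mul_left_comm]
        exact mul_le_mul_right (hL _ _) _
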